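/- Proofs, refutations and deductions in DC: for all formulas A and B, (i) the datum {{¬A∨B}} is DC-deducible from ⊤ if and only if {{B}} is DC-deducible from {{A}}; and (ii) the empty datum ⊥ is DC-deducible from the datum {{A, ¬B}} if and only if {{B}} is DC-deducible from {{A}}. -/

import Mathlib

/-- Formulas of classical propositional logic: propositional variables,
negation, conjunction, disjunction. -/
inductive Fml : Type
  | var : ℕ → Fml
  | neg : Fml → Fml
  | conj : Fml → Fml → Fml
  | disj : Fml → Fml → Fml
  deriving DecidableEq

/-- A datum: a finite set of finite sets (components) of formulas. -/
abbrev Datum := Finset (Finset Fml)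

/-- Truth-value of a formula under an interpretation of the variables. -/
def Fml.eval (v : ℕ → Bool) : Fml → Bool
  | .var n => v n
  | .neg A => !A.eval v
  | .conj A B => A.eval v && B.eval v
  | .disj A B => A.eval v || B.eval v

/-- An interpretation verifies a datum iff some component has all its
formulas true. -/
def Verifies (v : ℕ → Bool) (α : Datum) : Prop :=
  ∃ Γ ∈ α, ∀ A ∈ Γ, A.eval v = true

/-- The analytic G-rules of the Data Calculus DC. -/
inductive GStep : Datum → Datum → Prop
  | conj (Γ : Finset Fml) (A B : Fml) (ρ : Datum) :
      GStep (insert (insert (Fml.conj A B) Γ) ρ)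
            (insert (insert A (insert B Γ)) ρ)
  | disj (Γ : Finset Fml) (A B : Fml) (ρ : Datum) :
      GStep (insert (insert (Fml.disj A B) Γ) ρ)
            (insert (insert A Γ) (insert (insert B Γ) ρ))
  | negneg (Γ : Finset Fml) (A : Fml) (ρ : Datum) :
      GStep (insert (insert (Fml.neg (Fml.neg A)) Γ) ρ)
            (insert (insert A Γ) ρ)
  | negdisj (Γ : Finset Fml) (A B : Fml) (ρ : Datum) :
      GStep (insert (insert (Fml.neg (Fml.disj A B)) Γ) ρ)
            (insert (insert (Fml.neg A) (insert (Fml.neg B) Γ)) ρ)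
  | negconj (Γ : Finset Fml) (A B : Fml) (ρ : Datum) :
      GStep (insert (insert (Fml.neg (Fml.conj A B)) Γ) ρ)
            (insert (insert (Fml.neg A) Γ) (insert (insert (Fml.neg B) Γ) ρ))

/-- The analytic N-rule NC: delete a component containing a pair A, ¬A. -/
def NCStep (α β : Datum) : Prop :=
  ∃ (Γ : Finset Fml) (A : Fml),
    α = insert (insert A (insert (Fml.neg A) Γ)) β

/-- The synthetic N-rule EM: replace a component Γ by the two components
Γ∪{A} and Γ∪{¬A}. -/
def EMStep (α β : Datum) : Prop :=
  ∃ (Γ : Finset Fml) (A : Fml) (ρ : Datum),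
    α = insert Γ ρ ∧
    β = insert (insert A Γ) (insert (insert (Fml.neg A) Γ) ρ)

/-- The analytic S-rule Del: replace a component Γ∪Δ by its subset Γ. -/
def DelStep (α β : Datum) : Prop :=
  ∃ (Γ Δ : Finset Fml) (ρ : Datum),
    α = insert (Γ ∪ Δ) ρ ∧ β = insert Γ ρ

/-- The synthetic S-rule Exp: add an arbitrary new component. -/
def ExpStep (α β : Datum) : Prop :=
  ∃ Γ : Finset Fml, β = insert Γ α

/-- One step of the Data Calculus DC. -/
def DCStep (α β : Datum) : Prop :=
  GStep α β ∨ GStep β α ∨ NCStep α β ∨ EMStep α β ∨ DelStep α β ∨ ExpStep α β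

theorem gstep_union {α β : Datum} (σ : Datum) (h : GStep α β) : GStep (α ∪ σ) (β ∪ σ) := by
  cases h <;> simp only [Finset.insert_union] <;> constructor

theorem dcstep_union {α β : Datum} (σ : Datum) (h : DCStep α β) : DCStep (α ∪ σ) (β ∪ σ) := by
  rcases h with h | h | ⟨Γ, A, rfl⟩ | ⟨Γ, A, ρ, rfl, rfl⟩ | ⟨Γ, Δ, ρ, rfl, rfl⟩ | ⟨Γ, rfl⟩
  · exact .inl (gstep_union σ h)
  · exact .inr (.inl (gstep_union σ h))
  · exact .inr (.inr (.inl ⟨Γ, A, by simp only [Finset.insert_union]⟩))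
  · exact .inr (.inr (.inr (.inl ⟨Γ, A, ρ ∪ σ, by simp only [Finset.insert_union],
      by simp only [Finset.insert_union]⟩)))
  · exact .inr (.inr (.inr (.inr (.inl ⟨Γ, Δ, ρ ∪ σ, by simp only [Finset.insert_union],
      by simp only [Finset.insert_union]⟩))))
  · exact .inr (.inr (.inr (.inr (.inr ⟨Γ, by simp only [Finset.insert_union]⟩))))

theorem gstep_image {α β : Datum} (Θ : Finset Fml) (h : GStep α β) :
    GStep (α.image (· ∪ Θ)) (β.image (· ∪ Θ)) := by
  cases h <;> simp only [Finset.image_insert, Finset.insert_union] <;> constructor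

theorem dcstep_image {α β : Datum} (Θ : Finset Fml) (h : DCStep α β) :
    DCStep (α.image (· ∪ Θ)) (β.image (· ∪ Θ)) := by
  rcases h with h | h | ⟨Γ, A, rfl⟩ | ⟨Γ, A, ρ, rfl, rfl⟩ | ⟨Γ, Δ, ρ, rfl, rfl⟩ | ⟨Γ, rfl⟩
  · exact .inl (gstep_image Θ h)
  · exact .inr (.inl (gstep_image Θ h))
  · exact .inr (.inr (.inl ⟨Γ ∪ Θ, A, by simp only [Finset.image_insert, Finset.insert_union]⟩))
  · exact .inr (.inr (.inr (.inl ⟨Γ ∪ Θ, A, ρ.image (· ∪ Θ),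
      by simp only [Finset.image_insert],
      by simp only [Finset.image_insert, Finset.insert_union]⟩)))
  · exact .inr (.inr (.inr (.inr (.inl ⟨Γ ∪ Θ, Δ, ρ.image (· ∪ Θ),
      by simp only [Finset.image_insert, Finset.union_right_comm],
      by simp only [Finset.image_insert]⟩))))
  · exact .inr (.inr (.inr (.inr (.inr ⟨Γ ∪ Θ, by simp only [Finset.image_insert]⟩))))

theorem ded_union {α β : Datum} (σ : Datum) (h : Relation.ReflTransGen DCStep α β) :
    Relation.ReflTransGen DCStep (α ∪ σ) (β ∪ σ) :=
  Relation.ReflTransGen.lift (· ∪ σ) (fun _ _ => dcstep_union σ) _ _ h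

theorem ded_image {α β : Datum} (Θ : Finset Fml) (h : Relation.ReflTransGen DCStep α β) :
    Relation.ReflTransGen DCStep (α.image (· ∪ Θ)) (β.image (· ∪ Θ)) :=
  Relation.ReflTransGen.lift (fun α : Datum => α.image (· ∪ Θ)) (fun _ _ => dcstep_image Θ) _ _ h

theorem del_last (A B : Fml) : DCStep ({{A, B}} : Datum) {{B}} :=
  .inr (.inr (.inr (.inr (.inl ⟨{B}, {A}, ∅, by ext; simp [Finset.pair_comm], by simp⟩))))

/-- Proofs, refutations and deductions in DC: (i) {{¬A∨B}} is DC-deducible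
from ⊤ = {∅} iff {{B}} is DC-deducible from {{A}}; (ii) the empty datum ⊥ is
DC-deducible from {{A,¬B}} iff {{B}} is DC-deducible from {{A}}. -/
theorem dc_proofs_refutations_deductions (A B : Fml) :
    (Relation.ReflTransGen DCStep ({∅} : Datum)
        ({{Fml.disj (Fml.neg A) B}} : Datum) ↔
      Relation.ReflTransGen DCStep ({{A}} : Datum) ({{B}} : Datum)) ∧
    (Relation.ReflTransGen DCStep ({{A, Fml.neg B}} : Datum) (∅ : Datum) ↔
      Relation.ReflTransGen DCStep ({{A}} : Datum) ({{B}} : Datum)) := by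
  refine ⟨⟨fun h => ?_, fun h => ?_⟩, ⟨fun h => ?_, fun h => ?_⟩⟩
  · have h1 := ded_image {A} h
    have e1 : (({∅} : Datum).image (· ∪ {A})) = {{A}} := by simp
    have e2 : (({{Fml.disj (Fml.neg A) B}} : Datum).image (· ∪ {A})) =
        insert (insert (Fml.disj (Fml.neg A) B) {A}) ∅ := by simp [Finset.pair_comm]
    rw [e1, e2] at h1
    refine ((h1.tail (.inl (.disj {A} (Fml.neg A) B ∅))).tail
      (c := insert (insert B {A}) ∅) (.inr (.inr (.inl ⟨∅, A, ?_⟩)))).tail ?_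
    · simp [Finset.pair_comm]
    · simpa [Finset.pair_comm] using del_last A B
  · have h0 : DCStep ({∅} : Datum) ({{A}} ∪ {{Fml.neg A}}) :=
      .inr (.inr (.inr (.inl ⟨∅, A, ∅, by simp, by ext; simp⟩)))
    refine ((Relation.ReflTransGen.single h0).trans (ded_union _ h)).tail (.inr (.inl ?_))
    have := GStep.disj ∅ (Fml.neg A) B ∅
    convert this using 1
    all_goals (ext; simp [or_comm])
  · have h0 : DCStep ({{A}} : Datum) ({{A, Fml.neg B}} ∪ {{A, B}}) :=
      .inr (.inr (.inr (.inl ⟨{A}, B, ∅, by simp,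
        by ext; simp [or_comm, Finset.pair_comm]⟩)))
    refine ((Relation.ReflTransGen.single h0).trans (ded_union _ h)).tail ?_
    simpa using del_last A B
  · have h1 := ded_image {Fml.neg B} h
    have e1 : (({{A}} : Datum).image (· ∪ {Fml.neg B})) = {{A, Fml.neg B}} := by
      simp [Finset.pair_comm]
    have e2 : (({{B}} : Datum).image (· ∪ {Fml.neg B})) = {{B, Fml.neg B}} := by
      simp [Finset.pair_comm]
    rw [e1, e2] at h1
    exact h1.tail (.inr (.inr (.inl ⟨∅, B, by simp⟩)))
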